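/- arXiv:2110.14078 — 6 statements merged into one kernel-verified Lean document; each statement's English description precedes it below -/
import Mathlib

section
/- Let N ≥ 2 be an integer, η ∈ (0,1) a real, and M an integer with 1 ≤ M ≤ N. Let w, w' : {1,...,N} → ℝ be strictly positive weight vectors and S₀ ⊆ {1,...,N} a set such that w'ᵢ = wᵢ for every i ∉ S₀ and 0 < w'ᵢ ≤ wᵢ for every i ∈ S₀. Set W = ∑ᵢ wᵢ, W' = ∑ᵢ w'ᵢ, and α̂ᵢ = M((1−η)·w'ᵢ/W' + η/N). Let J ⊆ {1,...,N}, let yᵢ ∈ [0,1] for each i, and set ŷᵢ = yᵢ/α̂ᵢ if i ∈ J and ŷᵢ = 0 otherwise. Define updated weights w⁺ᵢ = wᵢ·exp(M·η·ŷᵢ/N) for i ∉ S₀ and w⁺ᵢ = wᵢ for i ∈ S₀, and W⁺ = ∑ᵢ w⁺ᵢ. Then W⁺/W ≤ 1 + (η/((1−η)·N))·∑_{i ∈ J∖S₀} yᵢ + ((e−2)·M·η²/((1−η)·N²))·∑_{i=1}^N ŷᵢ, where e is Euler's number. -/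
open Finset

theorem Real.exp_le_one_add_add_mul_sq {x : ℝ} (hx0 : 0 ≤ x) (hx1 : x ≤ 1) :
    Real.exp x ≤ 1 + x + (Real.exp 1 - 2) * x ^ 2 := by
  have tail (t : ℝ) : HasSum (fun n : ℕ => t ^ (n + 2) / ((n + 2).factorial : ℝ))
      (Real.exp t - (1 + t)) := by
    have h := NormedSpace.expSeries_div_hasSum_exp t
    rw [← Real.exp_eq_exp_ℝ] at h
    simpa [Finset.sum_range_succ] using (hasSum_nat_add_iff' 2).mpr h
  have h := hasSum_le (fun n => ?_) (tail x) ((tail 1).mul_right (x ^ 2))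
  · linarith
  · rw [one_pow, div_mul_eq_mul_div, one_mul]
    gcongr ?_ / _
    exact pow_le_pow_of_le_one hx0 hx1 (by omega)

/-- One-step weight-growth bound for the Exp3.M-VP exponential-weight update. -/
theorem exp3MVP_one_step_weight_growth
    (N M : ℕ) (hN : 2 ≤ N) (hM1 : 1 ≤ M) (hMN : M ≤ N)
    (η : ℝ) (hη0 : 0 < η) (hη1 : η < 1)
    (w w' : Fin N → ℝ) (hw : ∀ i, 0 < w i)
    (S₀ : Finset (Fin N))
    (hw'eq : ∀ i ∉ S₀, w' i = w i)
    (hw'pos : ∀ i ∈ S₀, 0 < w' i)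
    (hw'le : ∀ i ∈ S₀, w' i ≤ w i)
    (W W' : ℝ) (hW : W = ∑ i, w i) (hW' : W' = ∑ i, w' i)
    (αhat : Fin N → ℝ)
    (hαhat : ∀ i, αhat i = (M : ℝ) * ((1 - η) * w' i / W' + η / N))
    (J : Finset (Fin N))
    (y : Fin N → ℝ) (hy0 : ∀ i, 0 ≤ y i) (hy1 : ∀ i, y i ≤ 1)
    (yhat : Fin N → ℝ)
    (hyhat : ∀ i, yhat i = if i ∈ J then y i / αhat i else 0)
    (wplus : Fin N → ℝ)
    (hwplus : ∀ i, wplus i =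
      if i ∈ S₀ then w i else w i * Real.exp ((M : ℝ) * η * yhat i / N))
    (Wplus : ℝ) (hWplus : Wplus = ∑ i, wplus i) :
    Wplus / W ≤ 1 + (η / ((1 - η) * N)) * ∑ i ∈ J \ S₀, y i
      + ((Real.exp 1 - 2) * M * η ^ 2 / ((1 - η) * N ^ 2)) * ∑ i, yhat i := by
  have hN0 : (0 : ℝ) < N := by exact_mod_cast (by omega : 0 < N)
  have hM0 : (0 : ℝ) < M := by exact_mod_cast hM1
  have hη : 0 < 1 - η := by linarith
  have hw'0 : ∀ i, 0 < w' i := fun i => by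
    by_cases h : i ∈ S₀
    · exact hw'pos i h
    · exact hw'eq i h ▸ hw i
  have hw'w : ∀ i, w' i ≤ w i := fun i => by
    by_cases h : i ∈ S₀
    · exact hw'le i h
    · exact (hw'eq i h).le
  have hne : (Finset.univ : Finset (Fin N)).Nonempty := ⟨⟨0, by omega⟩, mem_univ _⟩
  have hW'0 : 0 < W' := hW' ▸ sum_pos (fun i _ => hw'0 i) hne
  have hW'W : W' ≤ W := by
    rw [hW, hW']
    exact sum_le_sum fun i _ => hw'w i
  have hW0 : 0 < W := hW'0.trans_le hW'W
  have hα_ge : ∀ i, M * η / N ≤ αhat i := fun i => by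
    have : 0 ≤ M * ((1 - η) * w' i / W') := by
      have := hw'0 i
      positivity
    rw [hαhat, mul_add, mul_div_assoc]
    linarith
  have hα0 : ∀ i, 0 < αhat i := fun i => lt_of_lt_of_le (by positivity) (hα_ge i)
  have hyhat0 : ∀ i, 0 ≤ yhat i := fun i => by
    rw [hyhat]
    split_ifs
    · exact div_nonneg (hy0 i) (hα0 i).le
    · exact le_rfl
  have hαy : ∀ i, αhat i * yhat i = if i ∈ J then y i else 0 := fun i => by
    rw [hyhat]
    split_ifs
    · exact mul_div_cancel₀ _ (hα0 i).ne'
    · exact mul_zero _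
  have hαy1 : ∀ i, αhat i * yhat i ≤ 1 := fun i => by
    rw [hαy]
    split_ifs
    · exact hy1 i
    · exact zero_le_one
  have he : 0 ≤ Real.exp 1 - 2 := by linarith [Real.exp_one_gt_two]
  have hterm : ∀ i, wplus i / W ≤ w i / W
      + (η / ((1 - η) * N)) * (if i ∈ J \ S₀ then y i else 0)
      + ((Real.exp 1 - 2) * M * η ^ 2 / ((1 - η) * N ^ 2)) * yhat i := fun i => by
    have hc : 0 ≤ (Real.exp 1 - 2) * M * η ^ 2 / ((1 - η) * N ^ 2) := by positivity
    by_cases hi : i ∈ S₀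
    · simpa [hwplus, hi] using mul_nonneg hc (hyhat0 i)
    have hz0 : 0 ≤ M * η * yhat i / N := by
      have := hyhat0 i
      positivity
    have hz1 : M * η * yhat i / N ≤ 1 := by
      have := mul_le_mul_of_nonneg_right (hα_ge i) (hyhat0 i)
      rw [div_mul_eq_mul_div] at this
      exact this.trans (hαy1 i)
    have hp : w i / W ≤ αhat i / (M * (1 - η)) := by
      have h1 : w i / W ≤ w' i / W' := by
        rw [hw'eq i hi]
        exact div_le_div_of_nonneg_left (hw i).le hW'0 hW'W
      have h2 : αhat i / (M * (1 - η)) = w' i / W' + η / N / (1 - η) := by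
        rw [hαhat]
        field_simp
      have h3 : 0 ≤ η / N / (1 - η) := by positivity
      linarith
    have hJ : (if i ∈ J \ S₀ then y i else 0) = αhat i * yhat i := by
      simp [hαy, hi]
    rw [hwplus, if_neg hi, hJ]
    calc w i * Real.exp (M * η * yhat i / N) / W
        = w i / W * Real.exp (M * η * yhat i / N) := by ring
      _ ≤ w i / W * (1 + M * η * yhat i / N
            + (Real.exp 1 - 2) * (M * η * yhat i / N) ^ 2) :=
          mul_le_mul_of_nonneg_left (Real.exp_le_one_add_add_mul_sq hz0 hz1)
            (div_pos (hw i) hW0).le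
      _ = w i / W + w i / W * (M * η * yhat i / N
            + (Real.exp 1 - 2) * (M * η * yhat i / N) ^ 2) := by ring
      _ ≤ w i / W + αhat i / (M * (1 - η)) * (M * η * yhat i / N
            + (Real.exp 1 - 2) * (M * η * yhat i / N) ^ 2) := by
          gcongr
      _ = w i / W + η / ((1 - η) * N) * (αhat i * yhat i)
            + (Real.exp 1 - 2) * M * η ^ 2 / ((1 - η) * N ^ 2)
              * (αhat i * yhat i * yhat i) := by
          field_simp
          ring
      _ ≤ _ := by
          gcongr
          exact mul_le_of_le_one_left (hyhat0 i) (hαy1 i)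
  calc Wplus / W = ∑ i, wplus i / W := by rw [hWplus, sum_div]
    _ ≤ _ := sum_le_sum fun i _ => hterm i
    _ = _ := by
      rw [sum_add_distrib, sum_add_distrib, ← mul_sum, ← mul_sum, ← sum_div, ← hW,
        div_self hW0.ne', sum_ite_mem, univ_inter]
end

section
/- Fix integers N ≥ 2, T ≥ 1 and integers a, b with 1 ≤ a ≤ b < N, and a real η ∈ (0,1). For each t = 1,...,T let M_t be an integer with a ≤ M_t ≤ b. Define weights recursively as follows: wᵢ(1) = 1 for all i ∈ {1,...,N}; at each step t choose a set S₀(t) ⊆ {1,...,N} and modified weights w'ᵢ(t) with w'ᵢ(t) = wᵢ(t) for i ∉ S₀(t) and 0 < w'ᵢ(t) ≤ wᵢ(t) for i ∈ S₀(t); set α̂ᵢ(t) = M_t·((1−η)·w'ᵢ(t)/W'_t + η/N) where W'_t = ∑_j w'_j(t); choose a set J_t ⊆ {1,...,N}; take rewards yᵢ(t) ∈ [0,1]; set ŷᵢ(t) = yᵢ(t)/α̂ᵢ(t) for i ∈ J_t and ŷᵢ(t) = 0 otherwise; and update wᵢ(t+1) = wᵢ(t)·exp(M_t·η·ŷᵢ(t)/N)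 for i ∉ S₀(t) and wᵢ(t+1) = wᵢ(t) for i ∈ S₀(t). Then for every subset A ⊆ {1,...,N} with |A| = b one has (1/b)·∑_{j∈A} ∑_{t : j ∉ S₀(t)} M_t·ŷ_j(t) ≤ (N/η)·ln(N/b) + (1/(1−η))·∑_{t=1}^T ∑_{i ∈ J_t∖S₀(t)} yᵢ(t) + ((e−2)·b·η/((1−η)·N))·∑_{t=1}^T ∑_{i=1}^N ŷᵢ(t), where e is Euler's number. -/
open Finset

theorem sum_fin_sub_eq (f : ℕ → ℝ) (T : ℕ) :
    ∑ t : Fin T, (f (t + 1) - f t) = f T - f 0 := by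
  rw [Fin.sum_univ_eq_sum_range (fun n => f (n + 1) - f n) T, Finset.sum_range_sub]

theorem mean_log_le_log_mean {ι : Type*} {A : Finset ι} (hA : A.Nonempty) {u : ι → ℝ}
    (hu : ∀ i ∈ A, 0 < u i) :
    (1 / (A.card : ℝ)) * ∑ i ∈ A, Real.log (u i) ≤
      Real.log ((∑ i ∈ A, u i) / A.card) := by
  have hc : (0 : ℝ) < A.card := by exact_mod_cast hA.card_pos
  have h := strictConcaveOn_log_Ioi.concaveOn.le_map_sum (t := A)
    (w := fun _ => 1 / (A.card : ℝ)) (p := u) (fun _ _ => by positivity)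
    (by simp [hc.ne']) hu
  simp only [smul_eq_mul, ← Finset.mul_sum] at h
  rwa [one_div_mul_eq_div (A.card : ℝ) (∑ i ∈ A, u i)] at h

/-- One round of the exponential-weights potential argument, with capped arms `S`. -/
theorem log_sum_weights_step {N m b : ℕ} (hN : 0 < N) (hm : 0 < m) (hmb : m ≤ b)
    {η : ℝ} (hη0 : 0 < η) (hη1 : η < 1) {S J : Finset (Fin N)}
    {v v' u α y z : Fin N → ℝ} (hv : ∀ i, 0 < v i)
    (hveq : ∀ i ∉ S, v' i = v i) (hvpos : ∀ i ∈ S, 0 < v' i) (hvle : ∀ i ∈ S, v' i ≤ v i)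
    (hα : ∀ i, α i = (m : ℝ) * ((1 - η) * v' i / (∑ j, v' j) + η / N))
    (hy0 : ∀ i, 0 ≤ y i) (hy1 : ∀ i, y i ≤ 1)
    (hz : ∀ i, z i = if i ∈ J then y i / α i else 0)
    (hu : ∀ i, u i = if i ∈ S then v i else v i * Real.exp ((m : ℝ) * η * z i / N)) :
    Real.log (∑ i, u i) - Real.log (∑ i, v i) ≤
      η / (N * (1 - η)) * ∑ i ∈ J \ S, y i
        + (Real.exp 1 - 2) * b * η ^ 2 / (N ^ 2 * (1 - η)) * ∑ i, z i := by
  have hNR : (0 : ℝ) < N := by exact_mod_cast hN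
  have hmR : (0 : ℝ) < m := by exact_mod_cast hm
  have hmbR : (m : ℝ) ≤ b := by exact_mod_cast hmb
  have hη : 0 < 1 - η := by linarith
  have he : 0 ≤ Real.exp 1 - 2 := by linarith [Real.add_one_le_exp (1 : ℝ)]
  have : Nonempty (Fin N) := ⟨⟨0, hN⟩⟩
  have hv' i : 0 < v' i := by
    by_cases hi : i ∈ S
    · exact hvpos i hi
    · rw [hveq i hi]; exact hv i
  have hvle' i : v' i ≤ v i := by
    by_cases hi : i ∈ S
    · exact hvle i hi
    · exact (hveq i hi).le
  have hW' : 0 < ∑ j, v' j := Finset.sum_pos (fun i _ => hv' i) Finset.univ_nonempty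
  have hWle : ∑ j, v' j ≤ ∑ j, v j := Finset.sum_le_sum fun i _ => hvle' i
  have hW : 0 < ∑ j, v j := hW'.trans_le hWle
  have hαlow i : (m : ℝ) * (η / N) ≤ α i := by
    rw [hα]
    have := hv' i
    gcongr
    exact le_add_of_nonneg_left (by positivity)
  have hαpos i : 0 < α i := lt_of_lt_of_le (by positivity) (hαlow i)
  have hz0 i : 0 ≤ z i := by
    rw [hz]
    split_ifs
    exacts [div_nonneg (hy0 i) (hαpos i).le, le_rfl]
  have hαz i : α i * z i = if i ∈ J then y i else 0 := by
    rw [hz]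
    split_ifs
    exacts [mul_div_cancel₀ _ (hαpos i).ne', mul_zero _]
  have hαz1 i : α i * z i ≤ 1 := by
    rw [hαz]
    split_ifs
    exacts [hy1 i, zero_le_one]
  have hx0 i : 0 ≤ (m : ℝ) * η * z i / N := by have := hz0 i; positivity
  have hx1 i : (m : ℝ) * η * z i / N ≤ 1 := by
    calc (m : ℝ) * η * z i / N = (m : ℝ) * (η / N) * z i := by ring
      _ ≤ α i * z i := mul_le_mul_of_nonneg_right (hαlow i) (hz0 i)
      _ ≤ 1 := hαz1 i
  have hprob i : v' i / (∑ j, v' j) ≤ α i / (m * (1 - η)) := by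
    rw [le_div_iff₀ (by positivity), hα]
    have : 0 ≤ (m : ℝ) * (η / N) := by positivity
    linear_combination this
  have hterm i : (u i - v i) / (∑ j, v j) ≤
      η / (N * (1 - η)) * (if i ∈ J \ S then y i else 0)
        + (Real.exp 1 - 2) * b * η ^ 2 / (N ^ 2 * (1 - η)) * z i := by
    have := hz0 i
    by_cases hi : i ∈ S
    · simp only [hu, hi, if_true, sub_self, zero_div, Finset.mem_sdiff, not_true, and_false,
        if_false, mul_zero, zero_add]
      positivity
    · set x := (m : ℝ) * η * z i / N with hx
      have hexp := Real.exp_le_one_add_add_mul_sq (hx0 i) (hx1 i)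
      rw [← hx] at hexp
      have hx0' : 0 ≤ x := hx0 i
      have hexp0 : 0 ≤ Real.exp x - 1 := by linarith [Real.add_one_le_exp x]
      have hJ : (if i ∈ J \ S then y i else 0) = α i * z i := by
        rw [hαz]; simp [hi]
      rw [hJ]
      calc (u i - v i) / (∑ j, v j) = v' i / (∑ j, v j) * (Real.exp x - 1) := by
            rw [hu, if_neg hi, hveq i hi]; ring
        _ ≤ v' i / (∑ j, v' j) * (Real.exp x - 1) := by
            have := hv' i
            gcongr
        _ ≤ α i / (m * (1 - η)) * (x + (Real.exp 1 - 2) * x ^ 2) := by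
            refine mul_le_mul (hprob i) (by linarith) hexp0 ?_
            have := hαpos i
            positivity
        _ = η / (N * (1 - η)) * (α i * z i)
            + (Real.exp 1 - 2) * m * η ^ 2 / (N ^ 2 * (1 - η)) * (α i * z i * z i) := by
            rw [hx]; field_simp
        _ ≤ η / (N * (1 - η)) * (α i * z i)
            + (Real.exp 1 - 2) * b * η ^ 2 / (N ^ 2 * (1 - η)) * z i := by
            have h1 : α i * z i * z i ≤ z i := mul_le_of_le_one_left (hz0 i) (hαz1 i)
            have h0 : 0 ≤ α i * z i * z i := mul_nonneg (mul_nonneg (hαpos i).le this) this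
            gcongr
  have hupos i : 0 < u i := by
    rw [hu]
    have := hv i
    split_ifs <;> positivity
  have hU : 0 < ∑ i, u i := Finset.sum_pos (fun i _ => hupos i) Finset.univ_nonempty
  rw [← Real.log_div hU.ne' hW.ne']
  calc Real.log ((∑ i, u i) / ∑ i, v i) ≤ (∑ i, u i) / (∑ i, v i) - 1 :=
        Real.log_le_sub_one_of_pos (by positivity)
    _ = ∑ i, (u i - v i) / (∑ j, v j) := by
        rw [← Finset.sum_div, Finset.sum_sub_distrib, sub_div, div_self hW.ne']
    _ ≤ _ := Finset.sum_le_sum fun i _ => hterm i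
    _ = _ := by
        rw [Finset.sum_add_distrib, ← Finset.mul_sum, ← Finset.mul_sum, Finset.sum_ite_mem,
          Finset.univ_inter]

/-- Deterministic master inequality for the Exp3.M-VP algorithm: for any fixed set `A`
of `b` arms, the cumulative importance-weighted reward of the arms in `A` (over the
rounds where they are not capped) is controlled by the algorithm's collected reward. -/
theorem exp3MVP_master_inequality
    (N T a b : ℕ) (hN : 2 ≤ N) (hT : 1 ≤ T)
    (ha : 1 ≤ a) (hab : a ≤ b) (hbN : b < N)
    (η : ℝ) (hη0 : 0 < η) (hη1 : η < 1)
    (M : Fin T → ℕ) (hMa : ∀ t, a ≤ M t) (hMb : ∀ t, M t ≤ b)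
    (w : ℕ → Fin N → ℝ) (hw0 : ∀ i, w 0 i = 1)
    (S₀ : Fin T → Finset (Fin N))
    (w' : Fin T → Fin N → ℝ)
    (hw'eq : ∀ (t : Fin T), ∀ i ∉ S₀ t, w' t i = w t i)
    (hw'pos : ∀ (t : Fin T), ∀ i ∈ S₀ t, 0 < w' t i)
    (hw'le : ∀ (t : Fin T), ∀ i ∈ S₀ t, w' t i ≤ w t i)
    (αhat : Fin T → Fin N → ℝ)
    (hαhat : ∀ (t : Fin T) (i : Fin N),
      αhat t i = (M t : ℝ) * ((1 - η) * w' t i / (∑ j, w' t j) + η / N))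
    (J : Fin T → Finset (Fin N))
    (y : Fin T → Fin N → ℝ) (hy0 : ∀ t i, 0 ≤ y t i) (hy1 : ∀ t i, y t i ≤ 1)
    (yhat : Fin T → Fin N → ℝ)
    (hyhat : ∀ (t : Fin T) (i : Fin N),
      yhat t i = if i ∈ J t then y t i / αhat t i else 0)
    (hupd : ∀ (t : Fin T) (i : Fin N),
      w ((t : ℕ) + 1) i =
        if i ∈ S₀ t then w t i
        else w t i * Real.exp ((M t : ℝ) * η * yhat t i / N)) :
    ∀ A : Finset (Fin N), A.card = b →
      (1 / (b : ℝ)) *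
          ∑ j ∈ A, ∑ t ∈ Finset.univ.filter (fun t : Fin T => j ∉ S₀ t),
            (M t : ℝ) * yhat t j
        ≤ ((N : ℝ) / η) * Real.log ((N : ℝ) / b)
          + (1 / (1 - η)) * ∑ t : Fin T, ∑ i ∈ J t \ S₀ t, y t i
          + ((Real.exp 1 - 2) * b * η / ((1 - η) * N)) *
              ∑ t : Fin T, ∑ i : Fin N, yhat t i := by
  intro A hA
  have hη : 0 < 1 - η := by linarith
  have hN0 : 0 < N := by lia
  have hNR : (0 : ℝ) < N := by exact_mod_cast hN0
  have hb0 : 0 < b := by lia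
  have hbR : (0 : ℝ) < b := by exact_mod_cast hb0
  have hAne : A.Nonempty := Finset.card_pos.mp (hA ▸ hb0)
  have hw : ∀ n ≤ T, ∀ i, 0 < w n i := by
    intro n
    induction n with
    | zero => intro _ i; simp [hw0]
    | succ n ih =>
      intro hn i
      have h := hupd ⟨n, hn⟩ i
      have hpos := ih (by lia) i
      rw [h]
      split_ifs <;> positivity
  have hlogw (j : Fin N) : Real.log (w T j) =
      η / N * ∑ t ∈ Finset.univ.filter (fun t : Fin T => j ∉ S₀ t), (M t : ℝ) * yhat t j := by
    have h := sum_fin_sub_eq (fun n => Real.log (w n j)) T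
    simp only [hw0, Real.log_one, sub_zero] at h
    rw [← h, Finset.sum_filter, Finset.mul_sum]
    refine Finset.sum_congr rfl fun t _ => ?_
    rw [hupd]
    by_cases hj : j ∈ S₀ t
    · simp [hj]
    · rw [if_neg hj, if_pos hj, Real.log_mul (hw t t.2.le j).ne' (Real.exp_pos _).ne',
        Real.log_exp]
      ring
  have hupper : Real.log (∑ i, w T i) - Real.log N ≤
      η / (N * (1 - η)) * ∑ t : Fin T, ∑ i ∈ J t \ S₀ t, y t i
        + (Real.exp 1 - 2) * b * η ^ 2 / (N ^ 2 * (1 - η)) * ∑ t : Fin T, ∑ i, yhat t i := by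
    have h := sum_fin_sub_eq (fun n => Real.log (∑ i, w n i)) T
    simp only [hw0, Finset.sum_const, Finset.card_univ, Fintype.card_fin, nsmul_eq_mul,
      mul_one] at h
    rw [← h, Finset.mul_sum, Finset.mul_sum, ← Finset.sum_add_distrib]
    exact Finset.sum_le_sum fun t _ =>
      log_sum_weights_step hN0 (ha.trans (hMa t)) (hMb t) hη0 hη1 (hw t t.2.le) (hw'eq t)
        (hw'pos t) (hw'le t) (hαhat t) (hy0 t) (hy1 t) (hyhat t) (hupd t)
  have hlower := mean_log_le_log_mean hAne fun i _ => hw T le_rfl i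
  have hApos : 0 < ∑ i ∈ A, w T i := Finset.sum_pos (fun i _ => hw T le_rfl i) hAne
  have hmono : Real.log (∑ i ∈ A, w T i) ≤ Real.log (∑ i, w T i) :=
    Real.log_le_log hApos <| Finset.sum_le_sum_of_subset_of_nonneg (Finset.subset_univ A)
      fun i _ _ => (hw T le_rfl i).le
  rw [hA, Real.log_div hApos.ne' hbR.ne', Finset.sum_congr rfl fun j _ => hlogw j,
    ← Finset.mul_sum] at hlower
  rw [Real.log_div hNR.ne' hbR.ne']
  have hkey := mul_le_mul_of_nonneg_left
    (hlower.trans (sub_le_sub_right (hmono.trans (sub_le_iff_le_add.mp hupper)) _))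
    (show 0 ≤ (N : ℝ) / η by positivity)
  calc _ = _ := by field_simp
    _ ≤ _ := hkey
    _ = _ := by field_simp; ring
end

section
/- Let N ≥ 2 be an integer, M an integer with 1 ≤ M < N, and η ∈ (0,1) a real. Let w : {1,...,N} → ℝ be strictly positive and set θ = (1/M − η/N)/(1−η). Suppose κ > 0 satisfies κ = θ·( κ·|{i : wᵢ ≥ κ}| + ∑_{i : wᵢ < κ} wᵢ ). Define w'ᵢ = min(wᵢ, κ), W' = ∑ᵢ w'ᵢ, and α̂ᵢ = M·((1−η)·w'ᵢ/W' + η/N). Then α̂ᵢ ≤ 1 for every i ∈ {1,...,N}, and α̂ᵢ = 1 if and only if wᵢ ≥ κ. -/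
open Finset

/-- Capping the terms of a finite sum at `κ` turns each term that is at least `κ` into `κ`
and leaves the others unchanged. -/
theorem sum_min_eq_mul_card_add_sum_filter {ι : Type*} (s : Finset ι) (w : ι → ℝ) (κ : ℝ) :
    ∑ i ∈ s, min (w i) κ
      = κ * ((s.filter (fun i => κ ≤ w i)).card : ℝ)
        + ∑ i ∈ s.filter (fun i => w i < κ), w i := by
  rw [← Finset.sum_filter_add_sum_filter_not s (fun i => κ ≤ w i)]
  simp only [not_le]
  congr 1
  · rw [Finset.sum_congr rfl fun i hi => min_eq_right (Finset.mem_filter.mp hi).2,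
      Finset.sum_const, nsmul_eq_mul, mul_comm]
  · exact Finset.sum_congr rfl fun i hi => min_eq_left (Finset.mem_filter.mp hi).2.le

/-- Correctness of the weight-capping step of Exp3.M-VP: capping the weights at the
threshold `κ` makes all selection probabilities at most `1`, with equality exactly on
the capped arms. -/
theorem exp3MVP_capping_correct
    (N M : ℕ) (hN : 2 ≤ N) (hM1 : 1 ≤ M) (hMN : M < N)
    (η : ℝ) (hη0 : 0 < η) (hη1 : η < 1)
    (w : Fin N → ℝ) (hw : ∀ i, 0 < w i)
    (θ : ℝ) (hθ : θ = (1 / (M : ℝ) - η / N) / (1 - η))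
    (κ : ℝ) (hκ0 : 0 < κ)
    (hκ : κ = θ * (κ * ((Finset.univ.filter (fun i : Fin N => κ ≤ w i)).card : ℝ)
      + ∑ i ∈ Finset.univ.filter (fun i : Fin N => w i < κ), w i))
    (w' : Fin N → ℝ) (hw' : ∀ i, w' i = min (w i) κ)
    (W' : ℝ) (hW' : W' = ∑ i, w' i)
    (αhat : Fin N → ℝ)
    (hαhat : ∀ i, αhat i = (M : ℝ) * ((1 - η) * w' i / W' + η / N)) :
    (∀ i, αhat i ≤ 1) ∧ (∀ i, αhat i = 1 ↔ κ ≤ w i) := by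
  have hWκ : κ = θ * W' := by
    rw [hW', Finset.sum_congr rfl fun i _ => hw' i, sum_min_eq_mul_card_add_sum_filter]
    exact hκ
  have hM : (0 : ℝ) < M := by exact_mod_cast hM1
  have hη : 0 < 1 - η := sub_pos.mpr hη1
  have hW : 0 < W' := by
    rw [hW']
    refine Finset.sum_pos (fun i _ => ?_) ⟨⟨0, by omega⟩, Finset.mem_univ _⟩
    rw [hw' i]
    exact lt_min (hw i) hκ0
  have hc : 0 < (M : ℝ) * (1 - η) / W' := by positivity
  have hθM : (M : ℝ) * ((1 - η) * θ + η / N) = 1 := by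
    rw [hθ, mul_div_cancel₀ _ hη.ne', sub_add_cancel, mul_one_div_cancel hM.ne']
  have hα : ∀ i, αhat i = 1 - (M : ℝ) * (1 - η) / W' * (κ - w' i) := by
    intro i
    have hθW : κ / W' = θ := by rw [hWκ, mul_div_cancel_right₀ _ hW.ne']
    rw [hαhat i]
    linear_combination hθM + (M : ℝ) * (1 - η) * hθW
  refine ⟨fun i => ?_, fun i => ?_⟩
  · rw [hα i, hw' i]
    exact sub_le_self _ (mul_nonneg hc.le (sub_nonneg.mpr (min_le_right _ _)))
  · rw [hα i, hw' i, sub_eq_self, mul_eq_zero, or_iff_right hc.ne', sub_eq_zero, eq_comm,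
      min_eq_right_iff]
end

section
/- Let N be an integer with N ≥ 2, let μ₁ > μ₂ > ... > μ_N > 0 be strictly decreasing reals, and let a be an integer with 1 ≤ a < N. For a probability vector d = (d₁,...,d_N) (d_k ≥ 0, ∑_k d_k = 1) define F_a(d) = ∑_{k=1}^N μ_k d_k − max_{J ⊆ {1,...,N}, |J| = a} ∑_{j∈J} μ_j d_j. If d* maximizes F_a over all probability vectors and K* = |supp(d*)| where supp(d*) = {k : d*_k > 0}, then supp(d*) = {1, 2, ..., K*}, i.e. the support consists of the K* locations with the highest rewards μ. -/
open Finset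

/-- The reward fraction captured by the defender's best fixed set of `a` scanned
locations, against attack frequency vector `d` and location rewards `μ`. -/
noncomputable def defenderBest (N a : ℕ) (μ d : Fin N → ℝ) : ℝ :=
  sSup {x : ℝ | ∃ J : Finset (Fin N), J.card = a ∧ x = ∑ j ∈ J, μ j * d j}

/-- The attacker's worst-case average reward margin `F_a(d)`. -/
noncomputable def attackerMargin (N a : ℕ) (μ d : Fin N → ℝ) : ℝ :=
  (∑ k, μ k * d k) - defenderBest N a μ d

/-- `d` is a probability vector over the `N` locations. -/
def IsProbVec (N : ℕ) (d : Fin N → ℝ) : Prop :=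
  (∀ k, 0 ≤ d k) ∧ ∑ k, d k = 1

theorem finite_setOf_scanned_sums (N a : ℕ) (μ d : Fin N → ℝ) :
    {x : ℝ | ∃ J : Finset (Fin N), J.card = a ∧ x = ∑ j ∈ J, μ j * d j}.Finite := by
  refine (Set.finite_range fun J : Finset (Fin N) => ∑ j ∈ J, μ j * d j).subset ?_
  rintro x ⟨J, -, rfl⟩
  exact ⟨J, rfl⟩

theorem sum_le_defenderBest {N a : ℕ} (μ d : Fin N → ℝ) {J : Finset (Fin N)} (hJ : J.card = a) :
    ∑ j ∈ J, μ j * d j ≤ defenderBest N a μ d :=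
  le_csSup (finite_setOf_scanned_sums N a μ d).bddAbove ⟨J, hJ, rfl⟩

theorem exists_defenderBest_eq_sum {N a : ℕ} (haN : a ≤ N) (μ d : Fin N → ℝ) :
    ∃ J : Finset (Fin N), J.card = a ∧ defenderBest N a μ d = ∑ j ∈ J, μ j * d j := by
  have hne : {x : ℝ | ∃ J : Finset (Fin N), J.card = a ∧ x = ∑ j ∈ J, μ j * d j}.Nonempty := by
    obtain ⟨J, -, hJ⟩ := Finset.exists_subset_card_eq (s := (Finset.univ : Finset (Fin N)))
      (n := a) (by simpa using haN)
    exact ⟨_, J, hJ, rfl⟩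
  exact hne.csSup_mem (finite_setOf_scanned_sums N a μ d)

/-- Permuting the reward masses `μ k * d k` among the locations and then adding the same positive
frequency to every location strictly increases the margin. -/
theorem attackerMargin_lt_of_perm {N a : ℕ} (haN : a < N) {μ d d' : Fin N → ℝ}
    (hμpos : ∀ k, 0 < μ k) (σ : Equiv.Perm (Fin N)) {δ : ℝ} (hδ : 0 < δ)
    (hd' : ∀ k, μ k * d' k = μ (σ k) * d (σ k) + δ * μ k) :
    attackerMargin N a μ d < attackerMargin N a μ d' := by
  obtain ⟨J, hJ, hbest⟩ := exists_defenderBest_eq_sum haN.le μ d'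
  have hJle : ∑ j ∈ J, μ (σ j) * d (σ j) ≤ defenderBest N a μ d := by
    have := sum_le_defenderBest μ d (J := J.map σ.toEmbedding) (by simpa using hJ)
    simpa using this
  obtain ⟨k, hk⟩ : ∃ k, k ∉ J := by
    by_contra! h
    rw [Finset.eq_univ_iff_forall.2 h, Finset.card_univ, Fintype.card_fin] at hJ
    exact haN.ne' hJ
  have hlt : ∑ j ∈ J, μ j < ∑ j, μ j :=
    Finset.sum_lt_sum_of_subset (Finset.subset_univ J) (Finset.mem_univ k) hk (hμpos k)
      fun j _ _ => (hμpos j).le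
  have hsum : ∑ k, μ (σ k) * d (σ k) = ∑ k, μ k * d k :=
    Equiv.sum_comp σ fun k => μ k * d k
  simp only [attackerMargin, hbest, hd', Finset.sum_add_distrib, ← Finset.mul_sum, hsum]
  linarith [mul_lt_mul_of_pos_left hlt hδ]

theorem pos_of_lt_of_pos_of_maximizer {N a : ℕ} (haN : a < N) {μ d : Fin N → ℝ}
    (hμpos : ∀ k, 0 < μ k) (hμstrict : ∀ k j : Fin N, k < j → μ j < μ k) (hd : IsProbVec N d)
    (hopt : ∀ d' : Fin N → ℝ, IsProbVec N d' → attackerMargin N a μ d' ≤ attackerMargin N a μ d)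
    {i j : Fin N} (hij : i < j) (hj : 0 < d j) : 0 < d i := by
  by_contra hi
  have hi0 : d i = 0 := le_antisymm (not_lt.1 hi) (hd.1 i)
  let σ := Equiv.swap i j
  let e : Fin N → ℝ := fun k => μ (σ k) * d (σ k) / μ k
  have he0 : ∀ k, 0 ≤ e k := fun k =>
    div_nonneg (mul_nonneg (hμpos _).le (hd.1 _)) (hμpos k).le
  have hle : ∀ k, e k ≤ d (σ k) := by
    intro k
    rw [div_le_iff₀ (hμpos k), mul_comm (d _)]
    by_cases hki : k = i
    · subst hki
      simp only [σ, Equiv.swap_apply_left]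
      exact mul_le_mul_of_nonneg_right (hμstrict _ _ hij).le hj.le
    by_cases hkj : k = j
    · subst hkj
      simp [σ, hi0]
    · simp [σ, Equiv.swap_apply_of_ne_of_ne hki hkj]
  have hlt : e i < d (σ i) := by
    rw [div_lt_iff₀ (hμpos i), mul_comm (d _)]
    simp only [σ, Equiv.swap_apply_left]
    exact mul_lt_mul_of_pos_right (hμstrict _ _ hij) hj
  have hsum : ∑ k, e k < 1 := by
    rw [← hd.2, ← Equiv.sum_comp σ d]
    exact Finset.sum_lt_sum (fun k _ => hle k) ⟨i, Finset.mem_univ i, hlt⟩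
  have hN : (0 : ℝ) < N := by exact_mod_cast (Nat.zero_le a).trans_lt haN
  have hδ : 0 < (1 - ∑ k, e k) / N := div_pos (sub_pos.2 hsum) hN
  refine (attackerMargin_lt_of_perm haN (d := d)
    (d' := fun k => e k + (1 - ∑ k, e k) / N) hμpos σ hδ fun k => ?_).not_ge
      (hopt _ ⟨fun k => add_nonneg (he0 k) hδ.le, ?_⟩)
  · rw [mul_add, mul_div_cancel₀ _ (hμpos k).ne', mul_comm (μ k) (_ / _)]
  · rw [Finset.sum_add_distrib, Finset.sum_const, Finset.card_univ, Fintype.card_fin,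
      nsmul_eq_mul, mul_div_cancel₀ _ hN.ne', add_sub_cancel]

theorem mem_iff_lt_card_of_isLowerSet {N : ℕ} {S : Finset (Fin N)}
    (hS : IsLowerSet (S : Set (Fin N))) (k : Fin N) : k ∈ S ↔ (k : ℕ) < S.card := by
  constructor
  · intro hk
    have h := Finset.card_le_card (s := Finset.Iic k) (t := S)
      fun i hi => hS (Finset.mem_Iic.1 hi) hk
    rw [Fin.card_Iic] at h
    omega
  · intro hlt
    by_contra hk
    have h := Finset.card_le_card (s := S) (t := Finset.Iio k)
      fun i hi => Finset.mem_Iio.2 (lt_of_not_ge fun hki => hk (hS hki hi))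
    rw [Fin.card_Iio] at h
    omega

/-- Support identification (Lemma 5.2 (ii)): with strictly decreasing rewards, the
support of any maximizer `d*` of `F_a` consists of the `K*` locations with the highest
rewards, where `K*` is the cardinality of the support. -/
theorem maximizer_support_is_top_rewards
    (N a : ℕ) (hN : 2 ≤ N) (ha1 : 1 ≤ a) (haN : a < N)
    (μ : Fin N → ℝ) (hμpos : ∀ k, 0 < μ k)
    (hμstrict : ∀ k j : Fin N, k < j → μ j < μ k)
    (d : Fin N → ℝ) (hd : IsProbVec N d)
    (hopt : ∀ d' : Fin N → ℝ, IsProbVec N d' →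
      attackerMargin N a μ d' ≤ attackerMargin N a μ d)
    (K : ℕ) (hK : K = (Finset.univ.filter (fun k : Fin N => 0 < d k)).card) :
    ∀ k : Fin N, 0 < d k ↔ (k : ℕ) < K := by
  intro k
  have hS : IsLowerSet ((Finset.univ.filter fun k : Fin N => 0 < d k : Finset (Fin N)) :
      Set (Fin N)) := by
    intro j i hij hj
    simp only [Finset.coe_filter, Finset.mem_univ, true_and, Set.mem_ofPred_eq] at hj ⊢
    rcases hij.eq_or_lt with rfl | hlt
    · exact hj
    · exact pos_of_lt_of_pos_of_maximizer haN hμpos hμstrict hd hopt hlt hj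
  rw [hK, ← mem_iff_lt_card_of_isLowerSet hS k]
  simp
end

section
/- Let N be an integer with N ≥ 2, let μ₁ ≥ μ₂ ≥ ... ≥ μ_N > 0 be reals, let b be an integer with 1 ≤ b < N, and let K be an integer with b ≤ K ≤ N. Set H_K = ∑_{k=1}^K 1/μ_k. Then for every vector l = (l₁,...,l_N) with 0 ≤ l_k ≤ 1 for all k and ∑_{k=1}^N l_k ≤ b, one has max_{1 ≤ k ≤ N} μ_k·(1 − l_k) ≥ (K − b)/H_K. -/
open Finset

/-- Lemma 5.3: if the defender's scan frequencies `l_k ∈ [0,1]` sum to at most `b`,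
then some location offers the attacker an average reward `μ_k (1 − l_k)` of at least
`(K − b)/H_K`, where `H_K = ∑_{k=1}^K 1/μ_k`. -/
theorem attacker_reward_lower_bound
    (N b K : ℕ) (hN : 2 ≤ N) (hb1 : 1 ≤ b) (hbN : b < N)
    (hbK : b ≤ K) (hKN : K ≤ N)
    (μ : Fin N → ℝ) (hμpos : ∀ k, 0 < μ k)
    (hμmono : ∀ k j : Fin N, k ≤ j → μ j ≤ μ k)
    (H : ℝ) (hH : H = ∑ k ∈ Finset.univ.filter (fun k : Fin N => (k : ℕ) < K), 1 / μ k)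
    (l : Fin N → ℝ) (hl0 : ∀ k, 0 ≤ l k) (hl1 : ∀ k, l k ≤ 1)
    (hlsum : ∑ k, l k ≤ (b : ℝ)) :
    ∃ k : Fin N, ((K : ℝ) - b) / H ≤ μ k * (1 - l k) := by
  by_contra! h
  set S := Finset.univ.filter (fun k : Fin N => (k : ℕ) < K) with hS
  have hcard : S.card = K := by
    rw [hS, Fin.card_filter_val_lt, min_eq_right hKN]
  have hne : S.Nonempty := Finset.card_pos.mp (by omega)
  have hHpos : 0 < H := hH ▸ Finset.sum_pos (fun k _ => one_div_pos.mpr (hμpos k)) hne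
  have hlt : ∑ k ∈ S, (1 - l k) < ∑ k ∈ S, ((K : ℝ) - b) / H * (1 / μ k) := by
    refine Finset.sum_lt_sum_of_nonempty hne fun k _ => ?_
    rw [mul_one_div, lt_div_iff₀ (hμpos k), mul_comm]
    exact h k
  rw [← Finset.mul_sum, ← hH, div_mul_cancel₀ _ hHpos.ne', Finset.sum_sub_distrib,
    Finset.sum_const, hcard, nsmul_eq_mul, mul_one] at hlt
  have hle : ∑ k ∈ S, l k ≤ ∑ k, l k :=
    Finset.sum_le_sum_of_subset_of_nonneg (Finset.subset_univ S) fun k _ _ => hl0 k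
  linarith
end

section
/- Let N and T be positive integers, let y : {1,...,T} × {1,...,N} → ℝ be nonnegative, and for each t let M_t be an integer with 1 ≤ M_t ≤ N. Then there exists a permutation σ of {1,...,N} such that ∑_{t=1}^T ∑_{k : σ(k) ≤ M_t} y(t,k) ≥ ∑_{t=1}^T (M_t/N)·∑_{k=1}^N y(t,k). In particular, there is a nested family of subsets A_1 ⊆ A_2 ⊆ ... ⊆ A_N of {1,...,N} with |A_M| = M for each M such that ∑_{t=1}^T ∑_{k ∈ A_{M_t}} y(t,k) ≥ ∑_{t=1}^T (M_t/N)·∑_{k=1}^N y(t,k). -/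
open Finset

theorem card_filter_perm_val_add_one_le {N m : ℕ} (hm : m ≤ N) (σ : Equiv.Perm (Fin N)) :
    #{k : Fin N | (σ k : ℕ) + 1 ≤ m} = m := by
  have h : #{k : Fin N | (σ k : ℕ) + 1 ≤ m} = #{j : Fin N | (j : ℕ) < m} :=
    Finset.card_equiv σ fun k => by simp
  rw [h, Fin.card_filter_val_lt, min_eq_right hm]

/-- Averaging over the cyclic shifts of the locations, each location lies among the first `m`
for exactly `m` of the shifts. -/
theorem sum_shift_sum_filter {N m : ℕ} [NeZero N] (hm : m ≤ N) (f : Fin N → ℝ) :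
    ∑ s : Fin N, ∑ k with ((Equiv.addRight s k : Fin N) : ℕ) + 1 ≤ m, f k = m * ∑ k, f k := by
  simp_rw [Finset.sum_filter]
  rw [Finset.sum_comm, Finset.mul_sum]
  refine Finset.sum_congr rfl fun k _ => ?_
  rw [← Finset.sum_filter, Finset.sum_const, nsmul_eq_mul]
  congr 2
  exact card_filter_perm_val_add_one_le hm (Equiv.addLeft k)

theorem exists_perm_weighted_sum_le {N : ℕ} {ι : Type*} [Fintype ι] [NeZero N]
    (y : ι → Fin N → ℝ) (M : ι → ℕ) (hM : ∀ t, M t ≤ N) :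
    ∃ σ : Equiv.Perm (Fin N),
      ∑ t, ((M t : ℝ) / N) * ∑ k, y t k ≤ ∑ t, ∑ k with (σ k : ℕ) + 1 ≤ M t, y t k := by
  have hN : (N : ℝ) ≠ 0 := NeZero.ne _
  have hsum : ∑ _s : Fin N, ∑ t, ((M t : ℝ) / N) * ∑ k, y t k
      ≤ ∑ s : Fin N, ∑ t, ∑ k with ((Equiv.addRight s k : Fin N) : ℕ) + 1 ≤ M t, y t k := by
    rw [Finset.sum_comm (s := Finset.univ (α := Fin N)),
      Finset.sum_comm (s := Finset.univ (α := Fin N))]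
    refine Finset.sum_le_sum fun t _ => le_of_eq ?_
    rw [sum_shift_sum_filter (hM t), Finset.sum_const, Finset.card_univ, Fintype.card_fin,
      nsmul_eq_mul]
    field_simp
  obtain ⟨s, -, hs⟩ := Finset.exists_le_of_sum_le Finset.univ_nonempty hsum
  exact ⟨Equiv.addRight s, hs⟩

/-- Probabilistic-method averaging claim for the variable-play benchmark: some ordering
of the `N` locations (equivalently, some nested family of location sets) collects at
least the fraction `M_t/N` of the attack mass at each round, in total. -/
theorem exists_perm_nested_family_benchmark
    (N T : ℕ) (hN : 1 ≤ N) (hT : 1 ≤ T)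
    (y : Fin T → Fin N → ℝ) (hy : ∀ t k, 0 ≤ y t k)
    (M : Fin T → ℕ) (hM1 : ∀ t, 1 ≤ M t) (hMN : ∀ t, M t ≤ N) :
    (∃ σ : Equiv.Perm (Fin N),
      ∑ t : Fin T, ((M t : ℝ) / N) * ∑ k, y t k
        ≤ ∑ t : Fin T,
            ∑ k ∈ Finset.univ.filter (fun k : Fin N => ((σ k : ℕ) + 1) ≤ M t), y t k) ∧
    (∃ A : ℕ → Finset (Fin N),
      (∀ m, m < N → A m ⊆ A (m + 1)) ∧
      (∀ m, 1 ≤ m → m ≤ N → (A m).card = m) ∧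
      ∑ t : Fin T, ((M t : ℝ) / N) * ∑ k, y t k
        ≤ ∑ t : Fin T, ∑ k ∈ A (M t), y t k) := by
  have : NeZero N := ⟨by omega⟩
  obtain ⟨σ, hσ⟩ := exists_perm_weighted_sum_le y M hMN
  refine ⟨⟨σ, hσ⟩, fun m => {k : Fin N | (σ k : ℕ) + 1 ≤ m}, fun m _ => ?_,
    fun m _ hm => card_filter_perm_val_add_one_le hm σ, hσ⟩
  exact Finset.monotone_filter_right _ fun k _ hk => Nat.le_succ_of_le hk
end
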